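/- arXiv:1601.02202 — 2 statements merged into one kernel-verified Lean document; each statement's English description precedes it below -/
import Mathlib

section
/- Let β > 1. Then for Lebesgue-almost all x ∈ [0,1), lim_{n→∞} (log q_{k_n(x)}(x) − (log β/2)·n)/√n = 0, where q_j(x) is the denominator of the j-th continued fraction convergent of x. (Here (6·log 2·log β/π²)·(π²/(12·log 2)) = (log β)/2.) -/
open MeasureTheory Filter Set

/-- The β-transformation `T_β x = βx - ⌊βx⌋` on `[0,1)`. -/
noncomputable def betaT (β : ℝ) (x : ℝ) : ℝ := β * x - ⌊β * x⌋

/-- The `i`-th digit (for `i ≥ 1`) of the β-expansion of `x`. -/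
noncomputable def betaEps (β : ℝ) (i : ℕ) (x : ℝ) : ℤ := ⌊β * (betaT β)^[i - 1] x⌋

/-- The cylinder of order `n` of the β-expansion containing `x`. -/
def betaCyl (β : ℝ) (n : ℕ) (x : ℝ) : Set ℝ :=
  {y ∈ Set.Ico (0:ℝ) 1 | ∀ i, 1 ≤ i → i ≤ n → betaEps β i y = betaEps β i x}

/-- The Gauss map, with `T 0 = 0`. -/
noncomputable def gaussMap (x : ℝ) : ℝ := if x = 0 then 0 else 1 / x - ⌊1 / x⌋

/-- The `i`-th partial quotient (for `i ≥ 1`) of the continued fraction expansion of `x`. -/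
noncomputable def cfA (i : ℕ) (x : ℝ) : ℤ := ⌊1 / (gaussMap^[i - 1] x)⌋

/-- The cylinder of order `m` of the continued fraction expansion containing `x`. -/
def cfCyl (m : ℕ) (x : ℝ) : Set ℝ :=
  {y ∈ Set.Ico (0:ℝ) 1 | ∀ i, 1 ≤ i → i ≤ m → cfA i y = cfA i x}

/-- `k_n(x)`: the exact number of partial quotients of the continued fraction of `x`
determined by the first `n` β-expansion digits of `x`. -/
noncomputable def kCF (β : ℝ) (n : ℕ) (x : ℝ) : ℕ :=
  sSup {m | betaCyl β n x ⊆ cfCyl m x}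

/-- Denominators `q_n(x)` of the continued fraction convergents of `x`
(`q_0 = 1`, `q_1 = a_1`, `q_n = a_n q_{n-1} + q_{n-2}`). -/
noncomputable def cfQ (x : ℝ) : ℕ → ℤ
  | 0 => 1
  | 1 => cfA 1 x
  | (n + 2) => cfA (n + 2) x * cfQ x (n + 1) + cfQ x n

/-- Numerators `p_n(x)` of the continued fraction convergents of `x`
(`p_0 = 0`, `p_1 = 1`, `p_n = a_n p_{n-1} + p_{n-2}`). -/
noncomputable def cfP (x : ℝ) : ℕ → ℤ
  | 0 => 0
  | 1 => 1
  | (n + 2) => cfA (n + 2) x * cfP x (n + 1) + cfP x n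

/-- `l_n(x)`: the length of the longest string of zeros just after the `n`-th digit
of the β-expansion of `x`. -/
noncomputable def lZero (β : ℝ) (n : ℕ) (x : ℝ) : ℕ :=
  sSup {k | ∀ j, 1 ≤ j → j ≤ k → betaEps β (n + j) x = 0}

noncomputable def qq (x : ℝ) : ℕ → ℤ
  | 0 => 0
  | 1 => 1
  | (n + 2) => cfA (n + 1) x * qq x (n + 1) + qq x n

noncomputable def pp (x : ℝ) : ℕ → ℤ
  | 0 => 1
  | 1 => 0
  | (n + 2) => cfA (n + 1) x * pp x (n + 1) + pp x n

lemma cfQ_eq_qq (x : ℝ) (n : ℕ) : cfQ x n = qq x (n + 1) := by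
  induction n using Nat.strong_induction_on with
  | _ n ih =>
    match n with
    | 0 => simp [cfQ, qq]
    | 1 => simp [cfQ, qq]
    | n + 2 => rw [cfQ, qq, ih (n+1) (by omega), ih n (by omega)]

lemma pq_det (x : ℝ) (m : ℕ) :
    pp x m * qq x (m + 1) - pp x (m + 1) * qq x m = (-1) ^ m := by
  induction m with
  | zero => simp [pp, qq]
  | succ m ih => rw [pp, qq, pow_succ, ← ih]; ring

lemma gauss_mem (x : ℝ) (hx : 0 ≤ x ∧ x < 1) (m : ℕ) :
    0 ≤ gaussMap^[m] x ∧ gaussMap^[m] x < 1 := by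
  induction m with
  | zero => simpa using hx
  | succ m ih =>
    rw [Function.iterate_succ_apply', gaussMap]
    split_ifs
    · norm_num
    · exact ⟨Int.fract_nonneg _, Int.fract_lt_one _⟩

lemma gauss_irr (x : ℝ) (hx : Irrational x) (m : ℕ) : Irrational (gaussMap^[m] x) := by
  induction m with
  | zero => simpa using hx
  | succ m ih =>
    rw [Function.iterate_succ_apply', gaussMap, if_neg ih.ne_zero, one_div]
    exact ih.inv.sub_intCast _

lemma gauss_pos (x : ℝ) (h : 0 ≤ x ∧ x < 1) (hx : Irrational x) (m : ℕ) :
    0 < gaussMap^[m] x :=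
  lt_of_le_of_ne (gauss_mem x h m).1 (Ne.symm (gauss_irr x hx m).ne_zero)

lemma cfA_pos (x : ℝ) (h : 0 ≤ x ∧ x < 1) (hx : Irrational x) (m : ℕ) :
    1 ≤ cfA (m + 1) x := by
  have := gauss_pos x h hx m
  rw [cfA, Int.le_floor, Nat.add_sub_cancel, le_div_iff₀ this]
  have := (gauss_mem x h m).2
  push_cast; linarith

lemma qq_pos (x : ℝ) (h : 0 ≤ x ∧ x < 1) (hx : Irrational x) (m : ℕ) :
    0 ≤ qq x m ∧ 1 ≤ qq x (m + 1) := by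
  induction m with
  | zero => simp [qq]
  | succ m ih =>
    refine ⟨by linarith, ?_⟩
    rw [qq]; nlinarith [cfA_pos x h hx m]

lemma qq_mono (x : ℝ) (h : 0 ≤ x ∧ x < 1) (hx : Irrational x) : Monotone (qq x) := by
  refine monotone_nat_of_le_succ fun m => ?_
  match m with
  | 0 => simp [qq]
  | m + 1 => rw [qq]; nlinarith [cfA_pos x h hx m, qq_pos x h hx m]

lemma qq_ge (x : ℝ) (h : 0 ≤ x ∧ x < 1) (hx : Irrational x) (m : ℕ) :
    (m : ℤ) ≤ qq x (m + 1) := by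
  induction m with
  | zero => simp [qq]
  | succ m ih =>
    rw [qq]
    match m with
    | 0 => simp [qq]; have := cfA_pos x h hx 0; simpa using this
    | m + 1 =>
      have := qq_pos x h hx m
      have := qq_pos x h hx (m + 1)
      push_cast at *
      nlinarith [cfA_pos x h hx (m + 1)]

lemma pp_le (x : ℝ) (h : 0 ≤ x ∧ x < 1) (hx : Irrational x) (m : ℕ) :
    0 ≤ pp x m ∧ 0 ≤ pp x (m + 1) ∧ pp x (m + 1) ≤ qq x (m + 1) ∧
      pp x (m + 2) ≤ qq x (m + 2) := by
  induction m with
  | zero => simp [pp, qq]; have := cfA_pos x h hx 0; simpa using this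
  | succ m ih =>
    have h1 := cfA_pos x h hx m
    have h2 := cfA_pos x h hx (m + 1)
    refine ⟨ih.2.1, ?_, ih.2.2.2, ?_⟩
    · rw [pp]; nlinarith
    · rw [pp, qq]; nlinarith

lemma gauss_step (y : ℝ) (m : ℕ) (h : gaussMap^[m] y ≠ 0) :
    gaussMap^[m] y * (cfA (m + 1) y + gaussMap^[m + 1] y) = 1 := by
  rw [Function.iterate_succ_apply', cfA, Nat.add_sub_cancel, gaussMap, if_neg h]
  field_simp
  ring

/-- Moebius identity: `y` shares its first `m` digits with `x`. -/
lemma moebius (x y : ℝ) (m : ℕ) (hd : ∀ i < m, cfA (i + 1) y = cfA (i + 1) x)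
    (hp : ∀ i < m, 1 ≤ cfA (i + 1) x) :
    y * (qq x (m + 1) + qq x m * gaussMap^[m] y) = pp x (m + 1) + pp x m * gaussMap^[m] y := by
  induction m with
  | zero => simp [pp, qq]
  | succ m ih =>
    have ih := ih (fun i hi => hd i (by omega)) (fun i hi => hp i (by omega))
    have h0 : gaussMap^[m] y ≠ 0 := by
      intro h0
      have h1 := hp m (by omega)
      rw [← hd m (by omega), cfA, Nat.add_sub_cancel, h0] at h1
      simp at h1
    have hs := gauss_step y m h0
    rw [hd m (by omega)] at hs
    rw [pp, qq]
    push_cast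
    set t := gaussMap^[m] y
    set s := gaussMap^[m+1] y
    set a : ℝ := ((cfA (m + 1) x : ℤ) : ℝ)
    linear_combination (a + s) * ih - (y * qq x m - pp x m) * hs

lemma approx_le (x y : ℝ) (hy : 0 ≤ y ∧ y < 1) (h : 0 ≤ x ∧ x < 1) (hx : Irrational x)
    (m : ℕ) (hd : ∀ i < m, cfA (i + 1) y = cfA (i + 1) x) :
    |y - pp x (m + 1) / qq x (m + 1)| ≤ 1 / (qq x (m + 1) : ℝ) ^ 2 := by
  have hm := moebius x y m hd (fun i _ => cfA_pos x h hx i)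
  have ⟨q0, q1⟩ := qq_pos x h hx m
  have ⟨t0, t1⟩ := gauss_mem y hy m
  have hdet := pq_det x m
  have hdet : (pp x m * qq x (m + 1) - pp x (m + 1) * qq x m : ℝ) = (-1) ^ m := by exact_mod_cast hdet
  have q0 : (0:ℝ) ≤ qq x m := by exact_mod_cast q0
  have q1 : (1:ℝ) ≤ qq x (m + 1) := by exact_mod_cast q1
  set t := gaussMap^[m] y
  set q : ℝ := ((qq x (m + 1) : ℤ) : ℝ)
  set q' : ℝ := ((qq x m : ℤ) : ℝ)
  set p : ℝ := ((pp x (m + 1) : ℤ) : ℝ)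
  set p' : ℝ := ((pp x m : ℤ) : ℝ)
  have hpos : 0 < q + q' * t := by nlinarith [mul_nonneg q0 t0]
  have : y - p / q = (-1) ^ m * (t / (q * (q + q' * t))) := by
    rw [← hdet]; field_simp; linear_combination q * hm
  rw [this, abs_mul, abs_pow, abs_neg, abs_one, one_pow, one_mul, abs_of_nonneg (by positivity),
    div_le_div_iff₀ (by positivity) (by positivity)]
  nlinarith [mul_nonneg q0 t0, mul_nonneg (mul_nonneg q0 t0) (by linarith : 0 ≤ q), mul_pos (by linarith : 0 < q) (by linarith : 0 < q)]

lemma approx_le' (x : ℝ) (h : 0 ≤ x ∧ x < 1) (hx : Irrational x) (m : ℕ) :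
    |x - pp x (m + 1) / qq x (m + 1)| ≤ 1 / ((qq x (m + 1) : ℝ) * qq x (m + 2)) := by
  have hm := moebius x x m (fun _ _ => rfl) (fun i _ => cfA_pos x h hx i)
  have ⟨q0, q1⟩ := qq_pos x h hx m
  have q2 := (qq_pos x h hx (m+1)).2
  have t0 := gauss_pos x h hx m
  have hs := gauss_step x m t0.ne'
  have s0 := gauss_pos x h hx (m + 1)
  have hdet := pq_det x m
  have hdet : (pp x m * qq x (m + 1) - pp x (m + 1) * qq x m : ℝ) = (-1) ^ m := by exact_mod_cast hdet
  have q0 : (0:ℝ) ≤ qq x m := by exact_mod_cast q0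
  have q1 : (1:ℝ) ≤ qq x (m + 1) := by exact_mod_cast q1
  have q2 : (1:ℝ) ≤ qq x (m + 2) := by exact_mod_cast q2
  have hrec : (qq x (m + 2) : ℝ) = cfA (m + 1) x * qq x (m + 1) + qq x m := by
    rw [qq]; push_cast; ring
  set t := gaussMap^[m] x
  set s := gaussMap^[m+1] x
  set q : ℝ := ((qq x (m + 1) : ℤ) : ℝ)
  set q' : ℝ := ((qq x m : ℤ) : ℝ)
  set q'' : ℝ := ((qq x (m + 2) : ℤ) : ℝ)
  set p : ℝ := ((pp x (m + 1) : ℤ) : ℝ)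
  set p' : ℝ := ((pp x m : ℤ) : ℝ)
  set a : ℝ := ((cfA (m + 1) x : ℤ) : ℝ)
  have hpos : 0 < q + q' * t := by nlinarith [mul_nonneg q0 t0.le]
  have : x - p / q = (-1) ^ m * (t / (q * (q + q' * t))) := by
    rw [← hdet]; field_simp; linear_combination q * hm
  rw [this, abs_mul, abs_pow, abs_neg, abs_one, one_pow, one_mul, abs_of_nonneg (by positivity),
    div_le_div_iff₀ (by positivity) (by positivity)]
  have e : t * q'' = q + q' * t - t * s * q := by
    rw [hrec]; linear_combination q * hs
  have : t * q'' ≤ q + q' * t := by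
    rw [e]; have : 0 ≤ t * s * q := by positivity
    linarith
  nlinarith

/-- if `y` is not in the cylinder, there is a rational of small denominator in between -/
lemma cf_exists_rat_near (x y : ℝ) (hy : 0 ≤ y ∧ y < 1) (h : 0 ≤ x ∧ x < 1) (hx : Irrational x)
    (m : ℕ) (hne : y ∉ cfCyl m x) :
    ∃ p Q : ℤ, 1 ≤ Q ∧ Q ≤ 2 * qq x (m + 1) ∧ 0 ≤ p ∧ p ≤ Q ∧ |x - p / Q| ≤ |x - y| := by
  have hex : ∃ j, j < m ∧ cfA (j + 1) y ≠ cfA (j + 1) x := by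
    by_contra! hc
    refine hne ⟨hy, fun i h1 h2 => ?_⟩
    obtain ⟨j, rfl⟩ : ∃ j, i = j + 1 := ⟨i - 1, by omega⟩
    exact hc j (by omega)
  classical
  have hj := Nat.find_spec hex
  have hmin : ∀ i < Nat.find hex, cfA (i + 1) y = cfA (i + 1) x := by
    intro i hi
    have := Nat.find_min hex hi
    by_contra hc
    exact this ⟨by omega, hc⟩
  set j := Nat.find hex
  obtain ⟨hjm, hjne⟩ := hj
  have hmy := moebius x y j hmin (fun i _ => cfA_pos x h hx i)
  have hmx := moebius x x j (fun _ _ => rfl) (fun i _ => cfA_pos x h hx i)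
  have ⟨q0, q1⟩ := qq_pos x h hx j
  have hq2 := qq_mono x h hx (show j + 2 ≤ m + 1 by omega)
  have hq1 := qq_mono x h hx (show j + 1 ≤ j + 2 by omega)
  have q2 : qq x (j + 2) = cfA (j + 1) x * qq x (j + 1) + qq x j := by rw [qq]
  have hp := pp_le x h hx j
  have ha := cfA_pos x h hx j
  have t0 := gauss_pos x h hx j
  have ⟨s0, s1⟩ := gauss_mem y hy j
  rcases s0.eq_or_lt with hs | s0
  · refine ⟨pp x (j + 1), qq x (j + 1), q1, by linarith, hp.2.1, hp.2.2.1, ?_⟩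
    rw [← hs] at hmy
    have : (1:ℝ) ≤ qq x (j + 1) := by exact_mod_cast q1
    have : y = pp x (j + 1) / qq x (j + 1) := by
      field_simp; linarith
    rw [← this]
  have key : ∃ c : ℤ, 1 ≤ c ∧ c ≤ cfA (j + 1) x + 1 ∧
      0 ≤ (gaussMap^[j] x * c - 1) * (1 - gaussMap^[j] y * c) := by
    rw [cfA, cfA, Nat.add_sub_cancel] at hjne
    rw [cfA, Nat.add_sub_cancel] at ha ⊢
    rcases lt_or_gt_of_ne hjne with hlt | hlt
    · refine ⟨⌊1 / gaussMap^[j] x⌋, ha, by omega, ?_⟩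
      have h1 := Int.floor_lt.1 hlt
      have h2 := Int.floor_le (1 / gaussMap^[j] x)
      rw [div_lt_iff₀ s0] at h1
      rw [le_div_iff₀ t0] at h2
      nlinarith
    · refine ⟨⌊1 / gaussMap^[j] x⌋ + 1, by omega, le_rfl, ?_⟩
      have h1 := Int.lt_floor_add_one (1 / gaussMap^[j] x)
      have h2 := Int.le_floor.1 (Int.add_one_le_iff.2 hlt)
      rw [div_lt_iff₀ t0] at h1
      rw [le_div_iff₀ s0] at h2
      push_cast at *
      nlinarith
  obtain ⟨c, c1, c2, hc⟩ := key
  have hQ1 : 1 ≤ c * qq x (j + 1) + qq x j := by nlinarith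
  have hdet := pq_det x j
  have hdet : (pp x j * qq x (j + 1) - pp x (j + 1) * qq x j : ℝ) = (-1) ^ j := by exact_mod_cast hdet
  refine ⟨c * pp x (j + 1) + pp x j, c * qq x (j + 1) + qq x j, hQ1, ?_, ?_, ?_, ?_⟩
  · nlinarith
  · nlinarith
  · rcases Nat.eq_zero_or_pos j with h0 | h0
    · rw [h0]; simp [pp, qq]; exact c1
    · obtain ⟨i, hi⟩ : ∃ i, j = i + 1 := ⟨j - 1, by omega⟩
      rw [hi] at hp ⊢
      have := pp_le x h hx i
      nlinarith
  · push_cast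
    have q0 : (0:ℝ) ≤ qq x j := by exact_mod_cast q0
    have q1 : (1:ℝ) ≤ qq x (j + 1) := by exact_mod_cast q1
    have c1 : (1:ℝ) ≤ c := by exact_mod_cast c1
    set t := gaussMap^[j] x
    set s := gaussMap^[j] y
    set q : ℝ := ((qq x (j + 1) : ℤ) : ℝ)
    set q' : ℝ := ((qq x j : ℤ) : ℝ)
    set p : ℝ := ((pp x (j + 1) : ℤ) : ℝ)
    set p' : ℝ := ((pp x j : ℤ) : ℝ)
    have hX : 0 < q + q' * t := by nlinarith [mul_nonneg q0 t0.le]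
    have hY : 0 < q + q' * s := by nlinarith [mul_nonneg q0 s0.le]
    have hQ : 0 < c * q + q' := by nlinarith
    have ex : x = (p + p' * t) / (q + q' * t) := by rw [eq_div_iff hX.ne']; exact hmx
    have ey : y = (p + p' * s) / (q + q' * s) := by rw [eq_div_iff hY.ne']; exact hmy
    have e1 : x - (c * p + p') / (c * q + q') = (-1) ^ j * ((t * c - 1) / ((q + q' * t) * (c * q + q'))) := by
      rw [← hdet, ex]; field_simp; ring
    have e2 : (c * p + p') / (c * q + q') - y = (-1) ^ j * ((1 - s * c) / ((q + q' * s) * (c * q + q'))) := by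
      rw [← hdet, ey]; field_simp; ring
    set r := (c * p + p') / (c * q + q')
    have hprod : 0 ≤ (x - r) * (r - y) := by
      rw [e1, e2]
      have : ((-1:ℝ) ^ j) * (-1) ^ j = 1 := by rw [← mul_pow]; simp
      have e3 : (-1:ℝ) ^ j * ((t * c - 1) / ((q + q' * t) * (c * q + q'))) * ((-1) ^ j * ((1 - s * c) / ((q + q' * s) * (c * q + q')))) = ((-1:ℝ) ^ j * (-1) ^ j) * (((t * c - 1) * (1 - s * c)) / (((q + q' * t) * (c * q + q')) * ((q + q' * s) * (c * q + q')))) := by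
        field_simp
      rw [e3, this, one_mul]; positivity
    rw [← sq_le_sq]
    nlinarith [sq_nonneg (r - y)]
lemma beta_mem (β x : ℝ) (h : 0 ≤ x ∧ x < 1) (m : ℕ) :
    0 ≤ (betaT β)^[m] x ∧ (betaT β)^[m] x < 1 := by
  induction m with
  | zero => simpa using h
  | succ m ih =>
    rw [Function.iterate_succ_apply', betaT]
    exact ⟨Int.fract_nonneg _, Int.fract_lt_one _⟩

lemma beta_le (β x : ℝ) (hβ : 1 < β) (h : 0 ≤ x ∧ x < 1) (m : ℕ) :
    (betaT β)^[m + 1] x ≤ β * (betaT β)^[m] x := by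
  rw [Function.iterate_succ_apply', betaT]
  have h0 := (beta_mem β x h m).1
  have : (0:ℤ) ≤ ⌊β * (betaT β)^[m] x⌋ := Int.floor_nonneg.2 (by positivity)
  have : (0:ℝ) ≤ ⌊β * (betaT β)^[m] x⌋ := by exact_mod_cast this
  linarith

lemma beta_shift (β x δ : ℝ) (hβ : 1 < β) (h : 0 ≤ x ∧ x < 1) (hδ : 0 ≤ δ) (n : ℕ)
    (hn : β ^ n * δ ≤ (betaT β)^[n] x) :
    (betaT β)^[n] (x - δ) = (betaT β)^[n] x - β ^ n * δ ∧
      ∀ i < n, betaEps β (i + 1) (x - δ) = betaEps β (i + 1) x := by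
  induction n with
  | zero => simp
  | succ n ih =>
    have h1 : β ^ n * δ ≤ (betaT β)^[n] x := by
      have := hn.trans (beta_le β x hβ h n)
      rw [pow_succ] at this
      nlinarith
    obtain ⟨e, hd⟩ := ih h1
    have hfl : betaEps β (n + 1) (x - δ) = betaEps β (n + 1) x := by
      rw [betaEps, betaEps, Nat.add_sub_cancel, e, Int.floor_eq_iff]
      rw [Function.iterate_succ_apply', betaT, pow_succ] at hn
      have := Int.lt_floor_add_one (β * (betaT β)^[n] x)
      have : 0 ≤ β ^ n * δ * β := by positivity
      constructor <;> nlinarith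
    refine ⟨?_, ?_⟩
    · rw [Function.iterate_succ_apply', Function.iterate_succ_apply', betaT, betaT]
      rw [betaEps, betaEps, Nat.add_sub_cancel] at hfl
      rw [hfl, e, pow_succ]; ring
    · intro i hi
      rcases Nat.lt_succ_iff_lt_or_eq.1 hi with h' | rfl
      · exact hd i h'
      · exact hfl

lemma beta_diff (β x y : ℝ) (n : ℕ) (hd : ∀ i < n, betaEps β (i + 1) y = betaEps β (i + 1) x) :
    (betaT β)^[n] y - (betaT β)^[n] x = β ^ n * (y - x) := by
  induction n with
  | zero => simp
  | succ n ih =>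
    have ih := ih (fun i hi => hd i (by omega))
    have := hd n (by omega)
    rw [betaEps, betaEps, Nat.add_sub_cancel] at this
    rw [Function.iterate_succ_apply', Function.iterate_succ_apply', betaT, betaT, this, pow_succ]
    linear_combination β * ih

lemma betaCyl_dist (β x y : ℝ) (hβ : 1 < β) (n : ℕ) (h : 0 ≤ x ∧ x < 1) (hy : y ∈ betaCyl β n x) :
    |x - y| ≤ 1 / β ^ n := by
  have := beta_diff β x y n (fun i hi => hy.2 (i + 1) (by omega) (by omega))
  have h1 := beta_mem β x h n
  have h2 := beta_mem β y hy.1 n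
  have hb : 0 < β ^ n := by positivity
  rw [le_div_iff₀ hb, abs_sub_comm, ← abs_of_pos hb, ← abs_mul, mul_comm, ← this, abs_le]
  constructor <;> linarith

def bS (β : ℝ) (n : ℕ) : Set ℝ := {y | (0 ≤ y ∧ y < 1) ∧ (betaT β)^[n] y = 0}

lemma bD_sep (β y z : ℝ) (hβ : 1 < β) (n : ℕ) (hy : y ∈ bS β (n + 1)) (hy' : y ∉ bS β n)
    (hz : z ∈ bS β (n + 1)) (hlt : z < y) : 1 / β ^ (n + 1) ≤ y - z := by
  by_contra! hc
  rw [lt_div_iff₀ (by positivity)] at hc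
  obtain ⟨hy0, hy1⟩ := hy
  have hne : (betaT β)^[n] y ≠ 0 := fun h0 => hy' ⟨hy0, h0⟩
  have hpos : 0 < (betaT β)^[n] y := lt_of_le_of_ne (beta_mem β y hy0 n).1 (Ne.symm hne)
  rw [Function.iterate_succ_apply', betaT, sub_eq_zero] at hy1
  have hd1 : (0:ℝ) < ⌊β * (betaT β)^[n] y⌋ := by rw [← hy1]; positivity
  have hd1 : (1:ℤ) ≤ ⌊β * (betaT β)^[n] y⌋ := by exact_mod_cast hd1
  have hd2 : (1:ℝ) ≤ ⌊β * (betaT β)^[n] y⌋ := by exact_mod_cast hd1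
  have hle : β ^ n * (y - z) ≤ (betaT β)^[n] y := by
    rw [pow_succ] at hc
    nlinarith
  have hs := (beta_shift β y (y - z) hβ hy0 (by linarith) n hle).1
  rw [sub_sub_cancel] at hs
  have hz1 := hz.2
  rw [Function.iterate_succ_apply', betaT, sub_eq_zero, hs] at hz1
  set d := ⌊β * (betaT β)^[n] y⌋
  have hfl : ⌊β * ((betaT β)^[n] y - β ^ n * (y - z))⌋ = d - 1 := by
    rw [Int.floor_eq_iff]
    have e : β * ((betaT β)^[n] y - β ^ n * (y - z)) = d - (y - z) * β ^ (n + 1) := by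
      rw [← hy1]; ring
    have : 0 < (y - z) * β ^ (n + 1) := by
      have : 0 < y - z := by linarith
      positivity
    rw [e]; push_cast; constructor <;> linarith
  rw [hfl, mul_sub, hy1] at hz1
  push_cast at hz1
  rw [pow_succ] at hc
  linarith

lemma bD_card (β : ℝ) (hβ : 1 < β) (n : ℕ) :
    (bS β (n + 1) \ bS β n).Finite ∧ ((bS β (n + 1) \ bS β n).ncard : ℝ) ≤ 2 * β ^ (n + 1) := by
  have hb : 1 < β ^ (n + 1) := one_lt_pow₀ hβ (by omega)
  have hmap : ∀ y ∈ bS β (n + 1) \ bS β n, ⌊y * β ^ (n + 1)⌋₊ ∈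
      ((Finset.range (⌊β ^ (n + 1)⌋₊ + 1) : Finset ℕ) : Set ℕ) := by
    intro y hy
    have := hy.1.1
    simp only [Finset.coe_range, Set.mem_Iio]
    refine Nat.lt_succ_of_le (Nat.floor_le_floor ?_)
    nlinarith
  have hinj : Set.InjOn (fun y : ℝ => ⌊y * β ^ (n + 1)⌋₊) (bS β (n + 1) \ bS β n) := by
    have aux : ∀ y ∈ bS β (n + 1) \ bS β n, ∀ z ∈ bS β (n + 1) \ bS β n, z < y →
        ⌊y * β ^ (n + 1)⌋₊ ≠ ⌊z * β ^ (n + 1)⌋₊ := by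
      intro y hy z hz hlt he
      have hs := bD_sep β y z hβ n hy.1 hy.2 hz.1 hlt
      rw [div_le_iff₀ (by positivity)] at hs
      have hz0 : 0 ≤ z * β ^ (n + 1) := by have := hz.1.1.1; positivity
      have h1 := Nat.lt_floor_add_one (y * β ^ (n + 1))
      have h2 := Nat.floor_le hz0
      rw [he] at h1
      linarith
    intro y hy z hz he
    rcases lt_trichotomy y z with hl | hl | hl
    · exact absurd he.symm (aux z hz y hy hl)
    · exact hl
    · exact absurd he (aux y hy z hz hl)
  refine ⟨Set.Finite.of_injOn hmap hinj (Finset.finite_toSet _), ?_⟩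
  have := Set.ncard_le_ncard_of_injOn _ hmap hinj (Finset.finite_toSet _)
  rw [Set.ncard_coe_finset, Finset.card_range] at this
  have h2 := Nat.floor_le (show 0 ≤ β ^ (n + 1) by positivity)
  have : ((bS β (n + 1) \ bS β n).ncard : ℝ) ≤ ⌊β ^ (n + 1)⌋₊ + 1 := by exact_mod_cast this
  linarith

lemma bS_card (β : ℝ) (hβ : 1 < β) (n : ℕ) :
    (bS β n).Finite ∧ ((bS β n).ncard : ℝ) ≤ 2 * (n + 1) * β ^ n := by
  induction n with
  | zero =>
    have : bS β 0 = {0} := by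
      ext y; simp only [bS, Set.mem_ofPred_eq, Function.iterate_zero, id, Set.mem_singleton_iff]
      constructor
      · exact fun h => h.2
      · rintro rfl; norm_num
    rw [this]; simp
  | succ n ih =>
    obtain ⟨hf, hc⟩ := bD_card β hβ n
    have hsub : bS β (n + 1) ⊆ bS β n ∪ (bS β (n + 1) \ bS β n) := by
      intro y hy; by_cases h : y ∈ bS β n
      · exact Or.inl h
      · exact Or.inr ⟨hy, h⟩
    have hfu := ih.1.union hf
    refine ⟨hfu.subset hsub, ?_⟩
    have h1 := (Set.ncard_le_ncard hsub hfu).trans (Set.ncard_union_le _ _)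
    have h1 : ((bS β (n + 1)).ncard : ℝ) ≤ (bS β n).ncard + (bS β (n + 1) \ bS β n).ncard := by
      exact_mod_cast h1
    have h2 : β ^ n ≤ β ^ (n + 1) := pow_le_pow_right₀ hβ.le (by omega)
    have h3 : (2 * (n + 1) : ℝ) * β ^ n ≤ 2 * (n + 1) * β ^ (n + 1) := by gcongr
    push_cast
    nlinarith [ih.2]

/-- the exceptional set of short cylinders -/
def bB (β : ℝ) (n : ℕ) : Set ℝ :=
  {x | (0 ≤ x ∧ x < 1) ∧ volume (betaCyl β n x) < ENNReal.ofReal (1 / (β ^ n * (n + 1) ^ 3))}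

lemma bB_vol (β : ℝ) (hβ : 1 < β) (n : ℕ) :
    volume (bB β n) ≤ ENNReal.ofReal (2 / ((n:ℝ) + 1) ^ 2) := by
  obtain ⟨hf, hc⟩ := bS_card β hβ n
  set S := bS β n ∩ bB β n
  have hSf : S.Finite := hf.subset Set.inter_subset_left
  have hsub : bB β n ⊆ ⋃ y ∈ hSf.toFinset, betaCyl β n y := by
    rintro x ⟨hx, hv⟩
    have hb : 0 < β ^ n := by positivity
    have h1 := beta_mem β x hx n
    set δ := (betaT β)^[n] x / β ^ n with hδ
    have hδ0 : 0 ≤ δ := div_nonneg h1.1 hb.le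
    have hδ1 : β ^ n * δ = (betaT β)^[n] x := by rw [hδ]; field_simp
    obtain ⟨h2, h3⟩ := beta_shift β x δ hβ hx hδ0 n hδ1.le
    have hle : δ ≤ x := by
      have : ∀ k, (betaT β)^[k] x ≤ β ^ k * x := by
        intro k
        induction k with
        | zero => simp
        | succ k ih => 
          have := beta_le β x hβ hx k
          rw [pow_succ]; nlinarith
      rw [hδ, div_le_iff₀ hb]; linarith [this n]
    have heq : betaCyl β n (x - δ) = betaCyl β n x := by
      ext z
      simp only [betaCyl, Set.mem_ofPred_eq]
      refine and_congr_right fun _ => forall_congr' fun i => ?_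
      refine forall_congr' fun hi => forall_congr' fun hi' => ?_
      obtain ⟨j, rfl⟩ : ∃ j, i = j + 1 := ⟨i - 1, by omega⟩
      rw [h3 j (by omega)]
    have hy0 : 0 ≤ x - δ ∧ x - δ < 1 := ⟨by linarith, by linarith [hx.2]⟩
    refine Set.mem_biUnion (x := x - δ) ?_ ?_
    · simp only [Set.Finite.coe_toFinset]
      refine ⟨⟨hy0, by rw [h2, hδ1, sub_self]⟩, hy0, ?_⟩
      rw [heq]; exact hv
    · rw [heq]; exact ⟨hx, fun _ _ _ => rfl⟩
  refine (measure_mono hsub).trans ((measure_biUnion_finset_le _ _).trans ?_)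
  have h1 : ∑ y ∈ hSf.toFinset, volume (betaCyl β n y) ≤
      ∑ y ∈ hSf.toFinset, ENNReal.ofReal (1 / (β ^ n * (n + 1) ^ 3)) := by
    refine Finset.sum_le_sum fun y hy => ?_
    rw [Set.Finite.mem_toFinset] at hy
    exact hy.2.2.le
  refine h1.trans ?_
  rw [Finset.sum_const, nsmul_eq_mul, ← ENNReal.ofReal_natCast, ← ENNReal.ofReal_mul (by positivity)]
  apply ENNReal.ofReal_le_ofReal
  have h2 : (hSf.toFinset.card : ℝ) ≤ 2 * (n + 1) * β ^ n := by
    refine le_trans ?_ hc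
    rw [← Set.ncard_eq_toFinset_card S hSf]
    exact_mod_cast Set.ncard_le_ncard Set.inter_subset_left hf
  calc _ ≤ (2 * (n + 1) * β ^ n) * (1 / (β ^ n * ((n:ℝ) + 1) ^ 3)) := by gcongr
    _ = _ := by field_simp

/-- rational neighbourhoods -/
def rE (M K : ℝ) : Set ℝ :=
  {x | ∃ Q p : ℕ, 1 ≤ Q ∧ (Q : ℝ) ≤ M ∧ p ≤ Q ∧ |x - p / Q| ≤ 1 / (Q * K)}

lemma rE_vol (M K : ℝ) (hM : 0 ≤ M) (hK : 0 < K) :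
    volume (rE M K) ≤ ENNReal.ofReal (4 * M / K) := by
  have hsub : rE M K ⊆ ⋃ Q ∈ Finset.Icc 1 ⌊M⌋₊, ⋃ p ∈ Finset.range (Q + 1),
      Metric.closedBall ((p:ℝ) / Q) (1 / (Q * K)) := by
    rintro x ⟨Q, p, h1, h2, h3, h4⟩
    simp only [Set.mem_iUnion]
    refine ⟨Q, Finset.mem_Icc.2 ⟨h1, Nat.le_floor h2⟩, p, Finset.mem_range.2 (by omega), ?_⟩
    rw [Metric.mem_closedBall, Real.dist_eq]; exact h4
  refine (measure_mono hsub).trans ((measure_biUnion_finset_le _ _).trans ?_)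
  have h1 : ∀ Q ∈ Finset.Icc 1 ⌊M⌋₊, volume (⋃ p ∈ Finset.range (Q + 1),
      Metric.closedBall ((p:ℝ) / Q) (1 / (Q * K))) ≤ ENNReal.ofReal (4 / K) := by
    intro Q hQ
    have hQ1 : (1:ℝ) ≤ Q := by exact_mod_cast (Finset.mem_Icc.1 hQ).1
    refine (measure_biUnion_finset_le _ _).trans ?_
    simp only [Real.volume_closedBall]
    rw [Finset.sum_const, nsmul_eq_mul, ← ENNReal.ofReal_natCast, ← ENNReal.ofReal_mul (by positivity)]
    apply ENNReal.ofReal_le_ofReal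
    rw [Finset.card_range]; push_cast
    calc ((Q:ℝ) + 1) * (2 * (1 / (Q * K))) ≤ (2 * Q) * (2 * (1 / (Q * K))) := by gcongr; linarith
      _ = 4 / K := by field_simp; norm_num
  refine (Finset.sum_le_sum h1).trans ?_
  rw [Finset.sum_const, nsmul_eq_mul, ← ENNReal.ofReal_natCast, ← ENNReal.ofReal_mul (by positivity)]
  apply ENNReal.ofReal_le_ofReal
  rw [Nat.card_Icc, Nat.add_sub_cancel]
  calc (⌊M⌋₊ : ℝ) * (4 / K) ≤ M * (4 / K) := by gcongr; exact Nat.floor_le hM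
    _ = _ := by ring

lemma bc_of_le (s : ℕ → Set ℝ) (C : ℝ) (hC : 0 ≤ C)
    (hs : ∀ n, volume (s n) ≤ ENNReal.ofReal (C / ((n:ℝ) + 1) ^ 2)) :
    ∀ᵐ x ∂(volume : Measure ℝ), ∀ᶠ n in atTop, x ∉ s n := by
  apply ae_eventually_notMem
  refine ne_top_of_le_ne_top ?_ (ENNReal.tsum_le_tsum hs)
  have hsum : Summable (fun n : ℕ => C / ((n:ℝ) + 1) ^ 2) := by
    have := (summable_nat_add_iff 1).2 (Real.summable_one_div_nat_pow.2 (show 1 < 2 by norm_num))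
    have := this.mul_left C
    refine this.congr fun n => ?_
    push_cast; ring
  rw [← ENNReal.ofReal_tsum_of_nonneg (fun n => by positivity) hsum]
  exact ENNReal.ofReal_ne_top
lemma kCF_bounds (β x : ℝ) (hβ : 1 < β) (n : ℕ) (h : 0 ≤ x ∧ x < 1) (hx : Irrational x)
    (h1 : x ∉ bB β n)
    (h2 : x ∉ rE (√(β ^ n) / (n + 1)) (√(β ^ n) / (n + 1) * ((n:ℝ) + 1) ^ 2))
    (h3 : x ∉ rE (√(β ^ n) / (n + 1) / ((n:ℝ) + 1) ^ 2) (√(β ^ n) / (n + 1) / 2)) :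
    √(β ^ n) / ((n:ℝ) + 1) ^ 3 ≤ cfQ x (kCF β n x) ∧
      (cfQ x (kCF β n x) : ℝ) ^ 2 ≤ 2 * β ^ n * ((n:ℝ) + 1) ^ 3 := by
  have hb : 0 < β ^ n := by positivity
  have hvol : ENNReal.ofReal (1 / (β ^ n * ((n:ℝ) + 1) ^ 3)) ≤ volume (betaCyl β n x) := by
    by_contra! hc
    exact h1 ⟨h, hc⟩
  have hup : ∀ m, betaCyl β n x ⊆ cfCyl m x →
      (qq x (m + 1) : ℝ) ^ 2 ≤ 2 * β ^ n * ((n:ℝ) + 1) ^ 3 := by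
    intro m hm
    have hq : (1:ℝ) ≤ qq x (m + 1) := by exact_mod_cast (qq_pos x h hx m).2
    have hsub : betaCyl β n x ⊆ Metric.closedBall ((pp x (m + 1) : ℝ) / qq x (m + 1))
        (1 / (qq x (m + 1) : ℝ) ^ 2) := by
      intro y hy
      have hy2 := hm hy
      rw [Metric.mem_closedBall, Real.dist_eq]
      exact approx_le x y hy2.1 h hx m (fun i hi => hy2.2 (i + 1) (by omega) (by omega))
    have := hvol.trans (measure_mono hsub)
    rw [Real.volume_closedBall, ENNReal.ofReal_le_ofReal_iff (by positivity), mul_one_div,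
      div_le_div_iff₀ (by positivity) (by positivity)] at this
    linarith
  have hbdd : BddAbove {m | betaCyl β n x ⊆ cfCyl m x} := by
    refine ⟨⌈2 * β ^ n * ((n:ℝ) + 1) ^ 3⌉₊, fun m hm => ?_⟩
    have h5 := hup m hm
    have h6 : (m:ℝ) ≤ qq x (m + 1) := by exact_mod_cast qq_ge x h hx m
    have hq : (1:ℝ) ≤ qq x (m + 1) := by exact_mod_cast (qq_pos x h hx m).2
    have h7 : (m:ℝ) ≤ 2 * β ^ n * ((n:ℝ) + 1) ^ 3 := by nlinarith
    exact_mod_cast h7.trans (Nat.le_ceil _)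
  have hne : {m | betaCyl β n x ⊆ cfCyl m x}.Nonempty :=
    ⟨0, fun y hy => ⟨hy.1, fun i hi hi' => by omega⟩⟩
  have hk : betaCyl β n x ⊆ cfCyl (kCF β n x) x := Nat.sSup_mem hne hbdd
  have hk1 : ¬ betaCyl β n x ⊆ cfCyl (kCF β n x + 1) x := by
    intro hc
    have : kCF β n x + 1 ≤ kCF β n x := le_csSup hbdd hc
    omega
  set k := kCF β n x
  rw [cfQ_eq_qq]
  refine ⟨?_, hup k hk⟩
  have hB : 0 < √(β ^ n) := Real.sqrt_pos.2 hb
  have hBs : √(β ^ n) * √(β ^ n) = β ^ n := Real.mul_self_sqrt hb.le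
  set B := √(β ^ n)
  have hw : (0:ℝ) < n + 1 := by positivity
  have hN : 0 < B / (n + 1) := by positivity
  have hNB : B / (n + 1) * (B / (n + 1)) * ((n:ℝ) + 1) ^ 2 = β ^ n := by
    rw [← hBs]; field_simp
  obtain ⟨y, hy, hyn⟩ := Set.not_subset.1 hk1
  obtain ⟨p, Q, hQ1, hQ2, hp0, hpQ, hd⟩ := cf_exists_rat_near x y hy.1 h hx _ hyn
  have hd := hd.trans (betaCyl_dist β x y hβ n h hy)
  lift p to ℕ using hp0
  lift Q to ℕ using (by omega)
  have hq2 : B / (n + 1) / 2 < qq x (k + 2) := by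
    by_contra! hc
    have hQ2' : (Q:ℝ) ≤ 2 * qq x (k + 2) := by exact_mod_cast hQ2
    have hQ1' : (1:ℝ) ≤ Q := by exact_mod_cast hQ1
    have hQN : (Q:ℝ) ≤ B / (n + 1) := by linarith
    refine h2 ⟨Q, p, by exact_mod_cast hQ1, hQN, by exact_mod_cast hpQ, ?_⟩
    push_cast at hd
    refine hd.trans (one_div_le_one_div_of_le (by positivity) ?_)
    rw [← hNB, ← mul_assoc]
    gcongr
  by_contra! hc
  have hpk := pp_le x h hx k
  have hqk := (qq_pos x h hx k).2
  have happ := approx_le' x h hx k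
  obtain ⟨P, hP⟩ := Int.eq_ofNat_of_zero_le hpk.2.1
  obtain ⟨R, hR⟩ := Int.eq_ofNat_of_zero_le (show 0 ≤ qq x (k + 1) by omega)
  rw [hP, hR] at happ
  rw [hR] at hqk hc
  push_cast at happ hc
  have hR1 : (1:ℝ) ≤ R := by exact_mod_cast hqk
  refine h3 ⟨R, P, by exact_mod_cast hqk, ?_, ?_, ?_⟩
  · have : B / (n + 1) / ((n:ℝ) + 1) ^ 2 = B / ((n:ℝ) + 1) ^ 3 := by field_simp
    rw [this]; exact hc.le
  · have := hpk.2.2.1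
    rw [hP, hR] at this
    exact_mod_cast this
  · refine happ.trans (one_div_le_one_div_of_le (by positivity) ?_)
    gcongr

lemma log_div_sqrt_tendsto :
    Tendsto (fun n : ℕ => (3 * Real.log ((n:ℝ) + 1) + Real.log 2) / √(n:ℝ)) atTop (nhds 0) := by
  have h1 : Tendsto (fun x : ℝ => Real.log x / x ^ (1/2 : ℝ)) atTop (nhds 0) :=
    (isLittleO_log_rpow_atTop (by norm_num : (0:ℝ) < 1/2)).tendsto_div_nhds_zero
  have h2 : Tendsto (fun n : ℕ => Real.log (n:ℝ) / √(n:ℝ)) atTop (nhds 0) := by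
    refine (h1.comp tendsto_natCast_atTop_atTop).congr fun n => ?_
    simp [Real.sqrt_eq_rpow]
  have h3 : Tendsto (fun n : ℕ => (1:ℝ) / √(n:ℝ)) atTop (nhds 0) :=
    tendsto_const_nhds.div_atTop (Real.tendsto_sqrt_atTop.comp tendsto_natCast_atTop_atTop)
  have h4 := (h2.const_mul 3).add (h3.const_mul (4 * Real.log 2))
  simp only [mul_zero, add_zero] at h4
  refine squeeze_zero' (Eventually.of_forall fun n => ?_) ?_ h4
  · have : 0 ≤ Real.log ((n:ℝ) + 1) := Real.log_nonneg (by linarith [n.cast_nonneg (α := ℝ)])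
    positivity
  · filter_upwards [eventually_ge_atTop 1] with n hn
    have hn : (1:ℝ) ≤ n := by exact_mod_cast hn
    have : Real.log ((n:ℝ) + 1) ≤ Real.log 2 + Real.log n := by
      rw [← Real.log_mul (by norm_num) (by linarith)]
      exact Real.log_le_log (by linarith) (by linarith)
    have e : 3 * (Real.log (n:ℝ) / √(n:ℝ)) + 4 * Real.log 2 * (1 / √(n:ℝ)) =
      (3 * Real.log n + 4 * Real.log 2) / √(n:ℝ) := by ring
    rw [e]
    exact div_le_div_of_nonneg_right (by linarith) (Real.sqrt_nonneg _)

theorem log_q_kn_asymptotics (β : ℝ) (hβ : 1 < β) :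
    ∀ᵐ x ∂(volume.restrict (Set.Ico (0:ℝ) 1)),
      Tendsto (fun n : ℕ =>
          (Real.log (cfQ x (kCF β n x)) - (Real.log β / 2) * n) / Real.sqrt n)
        atTop (nhds 0) := by
  have a1 := bc_of_le (bB β) 2 (by norm_num) (bB_vol β hβ)
  have a2 := bc_of_le (fun n : ℕ => rE (√(β ^ n) / (n + 1)) (√(β ^ n) / (n + 1) * ((n:ℝ) + 1) ^ 2))
    4 (by norm_num) (fun n => by
      have hB : 0 < √(β ^ n) := Real.sqrt_pos.2 (by positivity)
      refine (rE_vol _ _ (by positivity) (by positivity)).trans (le_of_eq ?_)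
      congr 1; field_simp)
  have a3 := bc_of_le
    (fun n : ℕ => rE (√(β ^ n) / (n + 1) / ((n:ℝ) + 1) ^ 2) (√(β ^ n) / (n + 1) / 2))
    8 (by norm_num) (fun n => by
      have hB : 0 < √(β ^ n) := Real.sqrt_pos.2 (by positivity)
      refine (rE_vol _ _ (by positivity) (by positivity)).trans (le_of_eq ?_)
      congr 1; field_simp; norm_num)
  have a4 : ∀ᵐ x ∂(volume : Measure ℝ), Irrational x :=
    (Set.countable_range ((↑) : ℚ → ℝ)).ae_notMem _
  rw [ae_restrict_iff' measurableSet_Ico]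
  filter_upwards [a1, a2, a3, a4] with x h1 h2 h3 hx h
  refine squeeze_zero_norm' ?_ log_div_sqrt_tendsto
  filter_upwards [h1, h2, h3] with n h1 h2 h3
  obtain ⟨hlo, hhi⟩ := kCF_bounds β x hβ n h hx h1 h2 h3
  have hb : 0 < β ^ n := by positivity
  have hB : 0 < √(β ^ n) := Real.sqrt_pos.2 hb
  have hq : (0:ℝ) < cfQ x (kCF β n x) := lt_of_lt_of_le (by positivity) hlo
  have l1 := Real.log_le_log (by positivity) hlo
  have l2 := Real.log_le_log (by positivity) hhi
  rw [Real.log_div (by positivity) (by positivity), Real.log_sqrt hb.le, Real.log_pow,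
    Real.log_pow] at l1
  rw [Real.log_mul (by positivity) (by positivity), Real.log_mul (by positivity) (by positivity),
    Real.log_pow, Real.log_pow, Real.log_pow] at l2
  push_cast at l1 l2
  have p1 : 0 ≤ Real.log ((n:ℝ) + 1) := Real.log_nonneg (by linarith [n.cast_nonneg (α := ℝ)])
  have p2 : 0 ≤ Real.log 2 := Real.log_nonneg (by norm_num)
  rw [Real.norm_eq_abs, abs_div, abs_of_nonneg (Real.sqrt_nonneg _)]
  gcongr
  rw [abs_le]
  constructor <;> linarith
end

section
/- Let β > 1. Then for Lebesgue-almost all x ∈ [0,1), lim_{n→∞} (k_{n+1}(x) − k_n(x))/√(n·log log n) = 0. -/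
open MeasureTheory Filter Set

namespace KN

/-- shifted denominators -/
noncomputable def qq (a : ℕ → ℤ) : ℕ → ℝ
  | 0 => 0
  | 1 => 1
  | (n + 2) => a n * qq a (n + 1) + qq a n

/-- shifted numerators -/
noncomputable def pp (a : ℕ → ℤ) : ℕ → ℝ
  | 0 => 1
  | 1 => 0
  | (n + 2) => a n * pp a (n + 1) + pp a n

lemma qq_bounds (a : ℕ → ℤ) (ha : ∀ i, 1 ≤ a i) (m : ℕ) :
    0 ≤ qq a m ∧ 1 ≤ qq a (m+1) ∧ qq a m ≤ qq a (m+1) := by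
  induction m with
  | zero => simp [qq]
  | succ m ih =>
    obtain ⟨h1, h2, h3⟩ := ih
    have h : (1:ℝ) ≤ a m := by exact_mod_cast ha m
    have e : qq a (m+2) = a m * qq a (m+1) + qq a m := rfl
    refine ⟨by linarith, ?_, ?_⟩ <;> rw [e] <;> nlinarith

lemma qq_double (a : ℕ → ℤ) (ha : ∀ i, 1 ≤ a i) (m : ℕ) :
    2 * qq a (m+1) ≤ qq a (m+3) := by
  obtain ⟨h1, h2, h3⟩ := qq_bounds a ha (m+1)
  have h : (1:ℝ) ≤ a (m+1) := by exact_mod_cast ha (m+1)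
  have e : qq a (m+3) = a (m+1) * qq a (m+2) + qq a (m+1) := rfl
  rw [e]; nlinarith

lemma qq_pow (a : ℕ → ℤ) (ha : ∀ i, 1 ≤ a i) (m j : ℕ) :
    2 ^ j * qq a (m+1) ≤ qq a (m+2*j+1) := by
  induction j with
  | zero => simp
  | succ j ih =>
    have := qq_double a ha (m+2*j)
    have e : m + 2*(j+1)+1 = m+2*j+3 := by ring
    rw [e, pow_succ]; linarith

lemma det_sq (a : ℕ → ℤ) (m : ℕ) :
    (pp a (m+1) * qq a m - pp a m * qq a (m+1))^2 = 1 := by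
  induction m with
  | zero => simp [pp, qq]
  | succ m ih =>
    have e : qq a (m+2) = a m * qq a (m+1) + qq a m := rfl
    have e' : pp a (m+2) = a m * pp a (m+1) + pp a m := rfl
    rw [show m+1+1 = m+2 from rfl, e, e', ← ih]; ring

lemma gauss_range (y : ℝ) : gaussMap y ∈ Set.Ico (0:ℝ) 1 := by
  unfold gaussMap
  split_ifs
  · simp
  · exact ⟨Int.fract_nonneg (1/y), Int.fract_lt_one (1/y)⟩

lemma gauss_it_range (y : ℝ) (hy : y ∈ Set.Ico (0:ℝ) 1) (m : ℕ) :
    gaussMap^[m] y ∈ Set.Ico (0:ℝ) 1 := by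
  cases m with
  | zero => simpa using hy
  | succ m => rw [Function.iterate_succ_apply']; exact gauss_range _

lemma gauss_irr (y : ℝ) (hy : Irrational y) : Irrational (gaussMap y) := by
  unfold gaussMap
  rw [if_neg hy.ne_zero, one_div]
  exact hy.inv.sub_intCast _

lemma gauss_it_irr (y : ℝ) (hy : Irrational y) (m : ℕ) : Irrational (gaussMap^[m] y) := by
  induction m with
  | zero => simpa using hy
  | succ m ih => rw [Function.iterate_succ_apply']; exact gauss_irr _ ih

lemma cfA_succ (i : ℕ) (y : ℝ) : cfA (i+1) y = ⌊1 / gaussMap^[i] y⌋ := rfl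

lemma cfA_pos (x : ℝ) (hx : x ∈ Set.Ico (0:ℝ) 1) (hi : Irrational x) (i : ℕ) :
    1 ≤ cfA (i+1) x := by
  rw [cfA_succ]
  have h1 := gauss_it_range x hx i
  have h2 := gauss_it_irr x hi i
  have h3 : 0 < gaussMap^[i] x := lt_of_le_of_ne h1.1 (Ne.symm h2.ne_zero)
  rw [Int.le_floor, le_div_iff₀ h3]
  push_cast; linarith [h1.2]

/-- one Gauss step -/
lemma gauss_step (t : ℝ) (ht : t ∈ Set.Ico (0:ℝ) 1) (a : ℤ) (ha : 1 ≤ a) (h : ⌊1/t⌋ = a) :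
    0 < t ∧ gaussMap t = 1/t - a := by
  have h0 : t ≠ 0 := by
    rintro rfl
    simp at h; omega
  refine ⟨lt_of_le_of_ne ht.1 (Ne.symm h0), ?_⟩
  unfold gaussMap
  rw [if_neg h0, h]

lemma mob (a : ℕ → ℤ) (ha : ∀ i, 1 ≤ a i) (y : ℝ) (hy : y ∈ Set.Ico (0:ℝ) 1) (m : ℕ)
    (h : ∀ i < m, cfA (i+1) y = a i) :
    y * (qq a (m+1) + gaussMap^[m] y * qq a m) = pp a (m+1) + gaussMap^[m] y * pp a m := by
  induction m with
  | zero => simp [pp, qq]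
  | succ m ih =>
    have ih := ih (fun i hi => h i (by omega))
    obtain ⟨h0, h1⟩ := gauss_step _ (gauss_it_range y hy m) (a m) (ha m) (h m (by omega))
    rw [Function.iterate_succ_apply', h1]
    set t := gaussMap^[m] y
    have e : qq a (m+1+1) = a m * qq a (m+1) + qq a m := rfl
    have e' : pp a (m+1+1) = a m * pp a (m+1) + pp a m := rfl
    rw [e, e']
    field_simp
    linear_combination ih

lemma mob_diff (a : ℕ → ℤ) (ha : ∀ i, 1 ≤ a i) (y z : ℝ) (hy : y ∈ Set.Ico (0:ℝ) 1)
    (hz : z ∈ Set.Ico (0:ℝ) 1) (m : ℕ)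
    (h : ∀ i < m, cfA (i+1) y = a i) (h' : ∀ i < m, cfA (i+1) z = a i) :
    |y - z| * ((qq a (m+1) + gaussMap^[m] y * qq a m) * (qq a (m+1) + gaussMap^[m] z * qq a m))
      = |gaussMap^[m] y - gaussMap^[m] z| := by
  have e1 := mob a ha y hy m h
  have e2 := mob a ha z hz m h'
  have hd := det_sq a m
  obtain ⟨q0, q1, -⟩ := qq_bounds a ha m
  have t1 := (gauss_it_range y hy m).1
  have t2 := (gauss_it_range z hz m).1
  set t := gaussMap^[m] y
  set s := gaussMap^[m] z
  have p1 : 0 ≤ (qq a (m+1) + t * qq a m) * (qq a (m+1) + s * qq a m) := by positivity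
  rw [← abs_of_nonneg p1, ← abs_mul, ← sq_eq_sq₀ (abs_nonneg _) (abs_nonneg _), sq_abs, sq_abs]
  have : (y - z) * ((qq a (m+1) + t * qq a m) * (qq a (m+1) + s * qq a m))
    = - (t - s) * (pp a (m+1) * qq a m - pp a m * qq a (m+1)) := by
    linear_combination (qq a (m+1) + s * qq a m) * e1 - (qq a (m+1) + t * qq a m) * e2
  rw [this, mul_pow, hd]; ring

lemma exists_pt (a : ℕ → ℤ) (ha : ∀ i, 1 ≤ a i) (m : ℕ) : ∀ t ∈ Set.Ioo (0:ℝ) 1,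
    ∃ y ∈ Set.Ico (0:ℝ) 1, (∀ i < m, cfA (i+1) y = a i) ∧ gaussMap^[m] y = t := by
  induction m with
  | zero => intro t ht; exact ⟨t, ⟨ht.1.le, ht.2⟩, by simp, rfl⟩
  | succ m ih =>
    intro t ht
    have h : (1:ℝ) ≤ a m := by exact_mod_cast ha m
    have hp : 0 < (a m : ℝ) + t := by linarith [ht.1]
    obtain ⟨y, hy, h1, h2⟩ := ih (1 / (a m + t)) ⟨by positivity, by
      rw [div_lt_one hp]; linarith [ht.1]⟩
    have hf : ⌊1 / gaussMap^[m] y⌋ = a m := by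
      rw [h2, one_div_one_div, Int.floor_eq_iff]
      constructor <;> linarith [ht.1, ht.2]
    refine ⟨y, hy, ?_, ?_⟩
    · intro i hi
      rcases Nat.lt_succ_iff_lt_or_eq.1 hi with h | rfl
      · exact h1 i h
      · exact hf
    · rw [Function.iterate_succ_apply',
        (gauss_step _ (gauss_it_range y hy m) (a m) (ha m) hf).2, h2, one_div_one_div]
      ring

lemma cf_conn (a : ℕ → ℤ) (ha : ∀ i, 1 ≤ a i) (y z w : ℝ) (hy : y ∈ Set.Ico (0:ℝ) 1)
    (hz : z ∈ Set.Ico (0:ℝ) 1) (hw : w ∈ Set.Ico (0:ℝ) 1) (hyz : y ≤ z) (hzw : z ≤ w) (m : ℕ)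
    (h : ∀ i < m, cfA (i+1) y = a i) (h' : ∀ i < m, cfA (i+1) w = a i) :
    (∀ i < m, cfA (i+1) z = a i) ∧
    ((gaussMap^[m] y ≤ gaussMap^[m] z ∧ gaussMap^[m] z ≤ gaussMap^[m] w) ∨
     (gaussMap^[m] w ≤ gaussMap^[m] z ∧ gaussMap^[m] z ≤ gaussMap^[m] y)) := by
  induction m with
  | zero => simp [hyz, hzw]
  | succ m ih =>
    obtain ⟨i1, i2⟩ := ih (fun i hi => h i (by omega)) (fun i hi => h' i (by omega))
    have fy := h m (by omega)
    have fw := h' m (by omega)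
    obtain ⟨y0, y1⟩ := gauss_step _ (gauss_it_range y hy m) (a m) (ha m) fy
    obtain ⟨w0, w1⟩ := gauss_step _ (gauss_it_range w hw m) (a m) (ha m) fw
    rw [cfA_succ] at fy fw
    have z0 : 0 < gaussMap^[m] z := by rcases i2 with i2 | i2 <;> linarith
    have key : (1/gaussMap^[m] w ≤ 1/gaussMap^[m] z ∧ 1/gaussMap^[m] z ≤ 1/gaussMap^[m] y) ∨
        (1/gaussMap^[m] y ≤ 1/gaussMap^[m] z ∧ 1/gaussMap^[m] z ≤ 1/gaussMap^[m] w) := by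
      rcases i2 with i2 | i2
      · exact Or.inl ⟨one_div_le_one_div_of_le z0 i2.2, one_div_le_one_div_of_le y0 i2.1⟩
      · exact Or.inr ⟨one_div_le_one_div_of_le z0 i2.2, one_div_le_one_div_of_le w0 i2.1⟩
    have fz : ⌊1/gaussMap^[m] z⌋ = a m := by
      rcases key with k | k
      · apply le_antisymm
        · rw [← fy]; exact Int.floor_le_floor k.2
        · rw [← fw]; exact Int.floor_le_floor k.1
      · apply le_antisymm
        · rw [← fw]; exact Int.floor_le_floor k.2
        · rw [← fy]; exact Int.floor_le_floor k.1
    obtain ⟨-, z1⟩ := gauss_step _ (gauss_it_range z hz m) (a m) (ha m) fz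
    refine ⟨?_, ?_⟩
    · intro i hi
      rcases Nat.lt_succ_iff_lt_or_eq.1 hi with h | rfl
      · exact i1 i h
      · exact fz
    · simp only [Function.iterate_succ_apply', y1, w1, z1]
      rcases key with k | k
      · right; constructor <;> linarith
      · left; constructor <;> linarith

lemma cyl_idx (D : ℕ → ℝ → ℤ) (m : ℕ) (x y : ℝ) :
    (∀ i, 1 ≤ i → i ≤ m → D i y = D i x) ↔ ∀ i < m, D (i+1) y = D (i+1) x := by
  constructor
  · intro h i hi; exact h _ (by omega) (by omega)
  · intro h i h1 h2
    obtain ⟨j, rfl⟩ : ∃ j, i = j+1 := ⟨i-1, by omega⟩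
    exact h j (by omega)

lemma cfCyl_conn (x : ℝ) (hx : x ∈ Set.Ico (0:ℝ) 1) (hi : Irrational x) (m : ℕ) :
    (cfCyl m x).OrdConnected := by
  constructor
  rintro y ⟨hy, h⟩ w ⟨hw, h'⟩ z hz
  have hz' : z ∈ Set.Ico (0:ℝ) 1 := ⟨hy.1.trans hz.1, hz.2.trans_lt hw.2⟩
  rw [cyl_idx] at h h'
  refine ⟨hz', ?_⟩
  rw [cyl_idx]
  exact (cf_conn (fun i => cfA (i+1) x) (cfA_pos x hx hi) y z w hy hz' hw hz.1 hz.2 m h h').1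

lemma betaCyl_conn (β : ℝ) (hβ : 1 < β) (x : ℝ) (n : ℕ) :
    (betaCyl β n x).OrdConnected := by
  constructor
  rintro y ⟨hy, h⟩ w ⟨hw, h'⟩ z hz
  have hz' : z ∈ Set.Ico (0:ℝ) 1 := ⟨hy.1.trans hz.1, hz.2.trans_lt hw.2⟩
  rw [cyl_idx] at h h'
  refine ⟨hz', ?_⟩
  rw [cyl_idx]
  suffices H : (∀ i < n, betaEps β (i+1) z = betaEps β (i+1) x) ∧
    (betaT β)^[n] y ≤ (betaT β)^[n] z ∧ (betaT β)^[n] z ≤ (betaT β)^[n] w from H.1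
  induction n with
  | zero => simpa using hz
  | succ n ih =>
    obtain ⟨i1, i2, i3⟩ := ih (fun i hi => h i (by omega)) (fun i hi => h' i (by omega))
    have fy : ⌊β * (betaT β)^[n] y⌋ = betaEps β (n+1) x := h n (by omega)
    have fw : ⌊β * (betaT β)^[n] w⌋ = betaEps β (n+1) x := h' n (by omega)
    have k1 : β * (betaT β)^[n] y ≤ β * (betaT β)^[n] z := by gcongr
    have k2 : β * (betaT β)^[n] z ≤ β * (betaT β)^[n] w := by gcongr
    have fz : ⌊β * (betaT β)^[n] z⌋ = betaEps β (n+1) x := by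
      apply le_antisymm
      · rw [← fw]; exact Int.floor_le_floor k2
      · rw [← fy]; exact Int.floor_le_floor k1
    refine ⟨?_, ?_⟩
    · intro i hi
      rcases Nat.lt_succ_iff_lt_or_eq.1 hi with h | rfl
      · exact i1 i h
      · exact fz
    · have B : ∀ u, betaT β u = β * u - ⌊β * u⌋ := fun _ => rfl
      simp only [Function.iterate_succ_apply', B, fy, fz, fw]
      constructor <;> linarith

/-- length -/
noncomputable def len (S : Set ℝ) : ℝ := (volume S).toReal

lemma vol_ne_top {S : Set ℝ} (h : S ⊆ Set.Ico 0 1) : volume S ≠ ⊤ :=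
  ne_top_of_le_ne_top (by simp) (measure_mono h)

lemma len_mono {S U : Set ℝ} (h : U ⊆ Set.Ico 0 1) (hS : S ⊆ U) : len S ≤ len U :=
  ENNReal.toReal_mono (vol_ne_top h) (measure_mono hS)

lemma abs_le_len {S : Set ℝ} (h : S ⊆ Set.Ico 0 1) (hc : S.OrdConnected) {y z : ℝ} (hy : y ∈ S)
    (hz : z ∈ S) : |y - z| ≤ len S := by
  have h1 : Set.uIcc z y ⊆ S := hc.uIcc_subset hz hy
  have := len_mono h h1
  unfold len at this ⊢
  rwa [Set.uIcc, Real.volume_Icc, max_sub_min_eq_abs, ENNReal.toReal_ofReal (abs_nonneg _)] at this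

lemma len_le_of {S : Set ℝ} {r : ℝ} (hr : 0 ≤ r)
    (h : ∀ y ∈ S, ∀ z ∈ S, |y - z| ≤ r) : len S ≤ r := by
  unfold len
  apply ENNReal.toReal_le_of_le_ofReal hr
  refine (Real.volume_le_diam S).trans ?_
  apply Metric.ediam_le
  intro y hy z hz
  rw [edist_dist, Real.dist_eq]
  exact ENNReal.ofReal_le_ofReal (h y hy z hz)

lemma cf_len (x : ℝ) (hx : x ∈ Set.Ico (0:ℝ) 1) (hi : Irrational x) (m j : ℕ) :
    4 ^ j * len (cfCyl (m+2*j) x) ≤ 8 * len (cfCyl m x) := by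
  set a : ℕ → ℤ := fun i => cfA (i+1) x with ha'
  have ha : ∀ i, 1 ≤ a i := cfA_pos x hx hi
  have up : ∀ k, len (cfCyl k x) ≤ 1 / (qq a (k+1))^2 := by
    intro k
    obtain ⟨q0, q1, -⟩ := qq_bounds a ha k
    apply len_le_of (by positivity)
    rintro y ⟨hy, h⟩ z ⟨hz, h'⟩
    rw [cyl_idx] at h h'
    have e := mob_diff a ha y z hy hz k h h'
    have t1 := gauss_it_range y hy k
    have t2 := gauss_it_range z hz k
    have hl : |gaussMap^[k] y - gaussMap^[k] z| ≤ 1 := by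
      rw [abs_le]; constructor <;> linarith [t1.1, t1.2, t2.1, t2.2]
    rw [le_div_iff₀ (by positivity)]
    have : |y - z| * qq a (k+1)^2 ≤ |y - z| * ((qq a (k+1) + gaussMap^[k] y * qq a k) * (qq a (k+1) + gaussMap^[k] z * qq a k)) := by
      gcongr
      rw [sq]
      have s1 := mul_nonneg t1.1 q0
      have s2 := mul_nonneg t2.1 q0
      gcongr <;> linarith
    linarith
  have lo : 1 / (8 * (qq a (m+1))^2) ≤ len (cfCyl m x) := by
    obtain ⟨q0, q1, q2⟩ := qq_bounds a ha m
    obtain ⟨y, hy, h, t1⟩ := exists_pt a ha m (1/4) ⟨by norm_num, by norm_num⟩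
    obtain ⟨z, hz, h', t2⟩ := exists_pt a ha m (3/4) ⟨by norm_num, by norm_num⟩
    have e := mob_diff a ha y z hy hz m h h'
    rw [t1, t2] at e
    have hl := abs_le_len (S := cfCyl m x) (fun _ h => h.1) (cfCyl_conn x hx hi m)
      (y := y) (z := z) ⟨hy, (cyl_idx _ _ _ _).2 h⟩ ⟨hz, (cyl_idx _ _ _ _).2 h'⟩
    refine le_trans ?_ hl
    rw [div_le_iff₀ (by positivity)]
    have : |y - z| * ((qq a (m+1) + 1/4 * qq a m) * (qq a (m+1) + 3/4 * qq a m)) ≤ |y - z| * (4 * qq a (m+1)^2) := by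
      refine mul_le_mul_of_nonneg_left ?_ (abs_nonneg _)
      nlinarith
    rw [e] at this
    norm_num [abs_of_neg] at this
    linarith
  have hq := qq_pow a ha m j
  have q1 := (qq_bounds a ha m).2.1
  have u := up (m+2*j)
  calc 4 ^ j * len (cfCyl (m+2*j) x) ≤ 4^j * (1 / (qq a (m+2*j+1))^2) := by gcongr
    _ ≤ 4^j * (1 / (2 ^ j * qq a (m+1))^2) := by gcongr
    _ = 8 * (1 / (8 * (qq a (m+1))^2)) := by
      rw [show (4:ℝ) = 2^2 by norm_num, mul_pow, ← pow_mul, ← pow_mul, mul_comm j 2]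
      field_simp
    _ ≤ _ := by gcongr

lemma cf_len' (x : ℝ) (hx : x ∈ Set.Ico (0:ℝ) 1) (hi : Irrational x) (m d : ℕ) :
    2 ^ d * len (cfCyl (m+d) x) ≤ 16 * len (cfCyl m x) := by
  have hm : len (cfCyl (m+d) x) ≤ len (cfCyl (m+2*(d/2)) x) :=
    len_mono (fun _ h => h.1) (fun y h => ⟨h.1, fun i h1 h2 => h.2 i h1 (by omega)⟩)
  have h := cf_len x hx hi m (d/2)
  have h2 : (2:ℝ)^d ≤ 2 * 4^(d/2) := by
    rw [show (4:ℝ) = 2^2 by norm_num, ← pow_mul, ← pow_succ']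
    exact pow_le_pow_right₀ (by norm_num) (by omega)
  have h0 : 0 ≤ len (cfCyl (m+2*(d/2)) x) := ENNReal.toReal_nonneg
  calc 2 ^ d * len (cfCyl (m+d) x) ≤ (2 * 4^(d/2)) * len (cfCyl (m+2*(d/2)) x) :=
        mul_le_mul h2 hm ENNReal.toReal_nonneg (by positivity)
    _ ≤ _ := by linarith

end KN

namespace KN

/-- digit cylinder -/
def DC (D : ℕ → ℝ → ℤ) (m : ℕ) (w : Fin m → ℤ) : Set ℝ :=
  {y ∈ Set.Ico (0:ℝ) 1 | ∀ i : Fin m, D (i+1) y = w i}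

lemma DC_meas (D : ℕ → ℝ → ℤ) (hD : ∀ i, Measurable (D i)) (m : ℕ) (w : Fin m → ℤ) :
    MeasurableSet (DC D m w) := by
  have : DC D m w = Set.Ico (0:ℝ) 1 ∩ ⋂ i : Fin m, (D (i+1)) ⁻¹' {w i} := by
    ext y; simp [DC]
  rw [this]
  exact measurableSet_Ico.inter (MeasurableSet.iInter fun i => hD _ (measurableSet_singleton _))

lemma sum_bound (D : ℕ → ℝ → ℤ) (hD : ∀ i, Measurable (D i)) (m : ℕ)
    (B : (Fin m → ℤ) → Set ℝ) (c : ENNReal)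
    (h : ∀ w, volume (B w) ≤ c * volume (DC D m w)) : volume (⋃ w, B w) ≤ c := by
  calc volume (⋃ w, B w) ≤ ∑' w, volume (B w) := measure_iUnion_le _
    _ ≤ ∑' w, c * volume (DC D m w) := ENNReal.tsum_le_tsum h
    _ = c * volume (⋃ w, DC D m w) := by
      rw [ENNReal.tsum_mul_left, measure_iUnion]
      · intro w w' hne
        refine Set.disjoint_left.2 ?_
        rintro y ⟨-, h1⟩ ⟨-, h2⟩
        exact hne (funext fun i => (h1 i).symm.trans (h2 i))
      · exact fun w => DC_meas D hD m w
    _ ≤ c * volume (Set.Ico (0:ℝ) 1) := by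
      gcongr
      exact Set.iUnion_subset fun w y hy => hy.1
    _ = c := by simp

lemma betaT_meas (β : ℝ) : Measurable (betaT β) := by
  unfold betaT
  exact (measurable_const.mul measurable_id).sub
    (measurable_from_top.comp (Int.measurable_floor.comp (measurable_const.mul measurable_id)))

lemma betaEps_meas (β : ℝ) (i : ℕ) : Measurable (betaEps β i) :=
  Int.measurable_floor.comp (measurable_const.mul ((betaT_meas β).iterate _))

lemma gauss_meas : Measurable gaussMap := by
  unfold gaussMap
  refine Measurable.ite (measurableSet_singleton 0) measurable_const ?_
  have h : Measurable fun x : ℝ => 1 / x := measurable_const.div measurable_id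
  exact h.sub (measurable_from_top.comp (Int.measurable_floor.comp h))

lemma cfA_meas (i : ℕ) : Measurable (cfA i) :=
  Int.measurable_floor.comp (measurable_const.div (gauss_meas.iterate _))

lemma cfCyl_eq (m : ℕ) (x : ℝ) : cfCyl m x = DC cfA m (fun i => cfA (i+1) x) := by
  ext y
  simp only [cfCyl, DC, Set.mem_ofPred_eq, cyl_idx, Fin.forall_iff]

lemma betaCyl_eq (β : ℝ) (m : ℕ) (x : ℝ) :
    betaCyl β m x = DC (betaEps β) m (fun i => betaEps β (i+1) x) := by
  ext y
  simp only [betaCyl, DC, Set.mem_ofPred_eq, cyl_idx, Fin.forall_iff]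

lemma edge {S : Set ℝ} (h : S ⊆ Set.Ico 0 1) (hc : S.OrdConnected) (δ : ℝ) (hδ : 0 ≤ δ) :
    volume {x ∈ S | ∃ y ∉ S, |x - y| ≤ δ * len S} ≤ ENNReal.ofReal (2 * δ) * volume S := by
  have hL : 0 ≤ len S := ENNReal.toReal_nonneg
  have hb : BddBelow S := ⟨0, fun y hy => (h hy).1⟩
  have ha : BddAbove S := ⟨1, fun y hy => (h hy).2.le⟩
  have hs : {x ∈ S | ∃ y ∉ S, |x - y| ≤ δ * len S} ⊆
      Set.Icc (sInf S) (sInf S + δ * len S) ∪ Set.Icc (sSup S - δ * len S) (sSup S) := by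
    rintro x ⟨hx, y, hy, hxy⟩
    rw [abs_le] at hxy
    rcases lt_or_ge y x with hlt | hge
    · left
      refine ⟨csInf_le hb hx, ?_⟩
      have : y ≤ sInf S := le_csInf ⟨x, hx⟩ fun s hs => by
        by_contra hc'
        exact hy (hc.out hs hx ⟨(not_le.1 hc').le, hlt.le⟩)
      linarith
    · right
      refine ⟨?_, le_csSup ha hx⟩
      have : sSup S ≤ y := csSup_le ⟨x, hx⟩ fun s hs => by
        by_contra hc'
        exact hy (hc.out hx hs ⟨hge, (not_le.1 hc').le⟩)
      linarith
  refine (measure_mono hs).trans ((measure_union_le _ _).trans ?_)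
  rw [Real.volume_Icc, Real.volume_Icc]
  have e : volume S = ENNReal.ofReal (len S) := (ENNReal.ofReal_toReal (vol_ne_top h)).symm
  rw [e, ← ENNReal.ofReal_mul (by positivity), ← ENNReal.ofReal_add (by linarith [mul_nonneg hδ hL]) (by linarith [mul_nonneg hδ hL])]
  apply ENNReal.ofReal_le_ofReal
  linarith

lemma cf_event (m : ℕ) :
    volume {x | x ∈ Set.Ico (0:ℝ) 1 ∧ Irrational x ∧
      ∃ y ∉ cfCyl m x, |x - y| ≤ 1 / ((m:ℝ)+1)^2 * len (cfCyl m x)}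
      ≤ ENNReal.ofReal (2 * (1 / ((m:ℝ)+1)^2)) := by
  refine le_trans (measure_mono ?_) (sum_bound cfA cfA_meas m
    (fun w => {x | x ∈ DC cfA m w ∧ Irrational x ∧
      ∃ y ∉ DC cfA m w, |x - y| ≤ 1 / ((m:ℝ)+1)^2 * len (DC cfA m w)}) _ ?_)
  · rintro x ⟨hx, hi, h⟩
    rw [cfCyl_eq] at h
    exact Set.mem_iUnion.2 ⟨_, ⟨⟨hx, fun i => rfl⟩, hi, h⟩⟩
  · intro w
    rcases Set.eq_empty_or_nonempty {x | x ∈ DC cfA m w ∧ Irrational x ∧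
      ∃ y ∉ DC cfA m w, |x - y| ≤ 1 / ((m:ℝ)+1)^2 * len (DC cfA m w)} with h | ⟨x, hx, hi, -⟩
    · rw [h]; simp
    · have e : DC cfA m w = cfCyl m x := by
        rw [cfCyl_eq]; congr 1; funext i; exact (hx.2 i).symm
      refine le_trans (measure_mono ?_) (edge (fun y hy => hy.1) (e ▸ cfCyl_conn x hx.1 hi m)
        (1 / ((m:ℝ)+1)^2) (by positivity))
      rintro y ⟨h1, -, h2⟩
      exact ⟨h1, h2⟩

lemma betaT_range (β x : ℝ) : betaT β x ∈ Set.Ico (0:ℝ) 1 :=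
  ⟨Int.fract_nonneg (β * x), Int.fract_lt_one (β * x)⟩

lemma betaEps_range (β : ℝ) (hβ : 1 < β) (x : ℝ) (hx : x ∈ Set.Ico (0:ℝ) 1) (n : ℕ) :
    betaEps β (n+1) x ∈ Finset.Icc 0 ⌊β⌋ := by
  have h : (betaT β)^[n] x ∈ Set.Ico (0:ℝ) 1 := by
    cases n with
    | zero => simpa using hx
    | succ n => rw [Function.iterate_succ_apply']; exact betaT_range _ _
  have e : betaEps β (n+1) x = ⌊β * (betaT β)^[n] x⌋ := rfl
  rw [e, Finset.mem_Icc]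
  constructor
  · exact Int.floor_nonneg.2 (mul_nonneg (by linarith) h.1)
  · apply Int.floor_le_floor
    nlinarith [h.2]

lemma beta_event (β : ℝ) (hβ : 1 < β) (n : ℕ) :
    volume {x | x ∈ Set.Ico (0:ℝ) 1 ∧
      len (betaCyl β (n+1) x) ≤ 1 / ((n:ℝ)+1)^2 * len (betaCyl β n x)}
      ≤ (Finset.Icc 0 ⌊β⌋).card * ENNReal.ofReal (1 / ((n:ℝ)+1)^2) := by
  classical
  set sub : (Fin n → ℤ) → ℤ → Set ℝ :=
    fun w d => {y ∈ DC (betaEps β) n w | betaEps β (n+1) y = d} with hsub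
  refine le_trans (measure_mono ?_) (sum_bound (betaEps β) (betaEps_meas β) n
    (fun w => ⋃ d ∈ Finset.Icc 0 ⌊β⌋, if len (sub w d) ≤ 1 / ((n:ℝ)+1)^2 * len (DC (betaEps β) n w)
      then sub w d else ∅) _ ?_)
  · rintro x ⟨hx, h⟩
    have e : betaCyl β (n+1) x = sub (fun i => betaEps β (i+1) x) (betaEps β (n+1) x) := by
      ext y
      simp only [betaCyl, hsub, DC, Set.mem_ofPred_eq, cyl_idx, Fin.forall_iff]
      constructor
      · rintro ⟨h1, h2⟩
        exact ⟨⟨h1, fun i hi => h2 i (by omega)⟩, h2 n (by omega)⟩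
      · rintro ⟨⟨h1, h2⟩, h3⟩
        refine ⟨h1, fun i hi => ?_⟩
        rcases Nat.lt_succ_iff_lt_or_eq.1 hi with h | rfl
        · exact h2 i h
        · exact h3
    rw [e, betaCyl_eq] at h
    refine Set.mem_iUnion.2 ⟨fun i => betaEps β (i+1) x, ?_⟩
    refine Set.mem_iUnion₂.2 ⟨betaEps β (n+1) x, betaEps_range β hβ x hx n, ?_⟩
    rw [if_pos h]
    exact ⟨⟨hx, fun i => rfl⟩, rfl⟩
  · intro w
    refine (measure_biUnion_finset_le _ _).trans ?_
    rw [mul_assoc, ← nsmul_eq_mul]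
    refine Finset.sum_le_card_nsmul _ _ _ fun d _ => ?_
    split_ifs with h
    · have h1 : volume (sub w d) = ENNReal.ofReal (len (sub w d)) :=
        (ENNReal.ofReal_toReal (vol_ne_top fun y hy => hy.1.1)).symm
      have h2 : volume (DC (betaEps β) n w) = ENNReal.ofReal (len (DC (betaEps β) n w)) :=
        (ENNReal.ofReal_toReal (vol_ne_top fun y hy => hy.1)).symm
      rw [h1, h2, ← ENNReal.ofReal_mul (by positivity)]
      exact ENNReal.ofReal_le_ofReal h
    · simp

lemma summ : Summable fun n : ℕ => 1 / ((n:ℝ)+1)^2 := by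
  have := (summable_nat_add_iff 1).2 (Real.summable_one_div_nat_pow.2 (by norm_num : 1 < 2))
  simpa using this

lemma ae_facts (β : ℝ) (hβ : 1 < β) : ∀ᵐ x ∂(volume.restrict (Set.Ico (0:ℝ) 1)),
    x ∈ Set.Ico (0:ℝ) 1 ∧ Irrational x ∧
    (∃ M : ℕ, ∀ m ≥ M, ∀ y ∉ cfCyl m x, 1 / ((m:ℝ)+1)^2 * len (cfCyl m x) < |x - y|) ∧
    (∃ N : ℕ, ∀ n ≥ N, 1 / ((n:ℝ)+1)^2 * len (betaCyl β n x) < len (betaCyl β (n+1) x)) := by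
  have h1 := ae_eventually_notMem (μ := volume) (s := fun m : ℕ => {x | x ∈ Set.Ico (0:ℝ) 1 ∧
      Irrational x ∧ ∃ y ∉ cfCyl m x, |x - y| ≤ 1 / ((m:ℝ)+1)^2 * len (cfCyl m x)})
      (ne_top_of_le_ne_top (summ.mul_left 2).tsum_ofReal_ne_top (ENNReal.tsum_le_tsum cf_event))
  have h2 := ae_eventually_notMem (μ := volume) (s := fun n : ℕ => {x | x ∈ Set.Ico (0:ℝ) 1 ∧
      len (betaCyl β (n+1) x) ≤ 1 / ((n:ℝ)+1)^2 * len (betaCyl β n x)})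
      (ne_top_of_le_ne_top (by
        rw [ENNReal.tsum_mul_left]
        exact ENNReal.mul_ne_top (by simp) summ.tsum_ofReal_ne_top)
        (ENNReal.tsum_le_tsum (beta_event β hβ)))
  have h3 : ∀ᵐ x ∂(volume : Measure ℝ), Irrational x :=
    (Set.countable_range (fun q : ℚ => (q:ℝ))).ae_notMem volume
  rw [ae_restrict_iff' measurableSet_Ico]
  filter_upwards [h1, h2, h3] with x k1 k2 k3 hx
  refine ⟨hx, k3, ?_, ?_⟩
  · obtain ⟨M, hM⟩ := eventually_atTop.1 k1
    refine ⟨M, fun m hm y hy => ?_⟩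
    by_contra hc
    exact hM m hm ⟨hx, k3, y, hy, not_lt.1 hc⟩
  · obtain ⟨N, hN⟩ := eventually_atTop.1 k2
    refine ⟨N, fun n hn => ?_⟩
    by_contra hc
    exact hN n hn ⟨hx, not_lt.1 hc⟩

/-- the deterministic bound -/
lemma det_bound (β : ℝ) (hβ : 1 < β) (x : ℝ) (hx : x ∈ Set.Ico (0:ℝ) 1) (hi : Irrational x)
    (M : ℕ) (hM : ∀ m ≥ M, ∀ y ∉ cfCyl m x, 1 / ((m:ℝ)+1)^2 * len (cfCyl m x) < |x - y|)
    (N : ℕ) (hN : ∀ n ≥ N, 1 / ((n:ℝ)+1)^2 * len (betaCyl β n x) < len (betaCyl β (n+1) x)) :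
    ∃ C R : ℕ, ∀ n ≥ R, kCF β n x ≤ kCF β (n+1) x ∧
      ∃ d : ℕ, kCF β (n+1) x ≤ kCF β n x + d + C ∧ (2:ℝ)^d ≤ 16 * ((n:ℝ)+1)^8 := by
  have hJ1 : ∀ n, betaCyl β n x ⊆ Set.Ico (0:ℝ) 1 := fun n y hy => hy.1
  have hI1 : ∀ m, cfCyl m x ⊆ Set.Ico (0:ℝ) 1 := fun n y hy => hy.1
  have hJm : ∀ n, betaCyl β (n+1) x ⊆ betaCyl β n x := fun n y hy =>
    ⟨hy.1, fun i a b => hy.2 i a (by omega)⟩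
  have hIm : ∀ m m', m ≤ m' → cfCyl m' x ⊆ cfCyl m x := fun m m' h y hy =>
    ⟨hy.1, fun i a b => hy.2 i a (by omega)⟩
  have hxJ : ∀ n, x ∈ betaCyl β n x := fun n => ⟨hx, fun _ _ _ => rfl⟩
  have l0 : ∀ S, 0 ≤ len S := fun S => ENNReal.toReal_nonneg
  have hNpos : 0 < len (betaCyl β N x) := by
    have h := hN N le_rfl
    have h2 := len_mono (hJ1 N) (hJm N)
    have h3 : 0 ≤ 1 / ((N:ℝ)+1)^2 * len (betaCyl β N x) := mul_nonneg (by positivity) (l0 _)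
    linarith
  set c := len (betaCyl β N x) with hc
  have hlow : ∀ n ≥ N, c ≤ 4 ^ (n^2) * len (betaCyl β n x) := by
    intro n hn
    induction n, hn using Nat.le_induction with
    | base => exact le_mul_of_one_le_left hNpos.le (one_le_pow₀ (by norm_num))
    | succ n hn ih =>
      have h := hN n hn
      have h2 : ((n:ℝ)+1)^2 ≤ 4^n := by
        have : ((n:ℝ)+1) ≤ 2^n := by exact_mod_cast Nat.lt_two_pow_self (n := n)
        calc ((n:ℝ)+1)^2 ≤ (2^n)^2 := by gcongr
          _ = 4^n := by rw [← pow_mul, mul_comm, pow_mul]; norm_num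
      have h3 : len (betaCyl β n x) ≤ ((n:ℝ)+1)^2 * len (betaCyl β (n+1) x) := by
        rw [one_div, inv_mul_lt_iff₀ (by positivity)] at h; exact h.le
      have l1 := l0 (betaCyl β (n+1) x)
      calc c ≤ 4 ^ (n^2) * len (betaCyl β n x) := ih
        _ ≤ 4 ^ (n^2) * (((n:ℝ)+1)^2 * len (betaCyl β (n+1) x)) := by gcongr
        _ ≤ 4 ^ (n^2) * (4^n * len (betaCyl β (n+1) x)) := by gcongr
        _ = 4 ^ (n^2+n) * len (betaCyl β (n+1) x) := by rw [pow_add]; ring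
        _ ≤ _ := by
          gcongr
          · norm_num
          · nlinarith
  have hIlen : ∀ m, 2^m * len (cfCyl m x) ≤ 16 := by
    intro m
    have h := cf_len' x hx hi 0 m
    have h1 : len (cfCyl 0 x) ≤ 1 := by
      have := len_mono (le_refl _) (hI1 0)
      simpa [len] using this
    rw [zero_add] at h; linarith
  obtain ⟨K, hK⟩ := pow_unbounded_of_one_lt (16 / c) (by norm_num : (1:ℝ) < 2)
  have hKb : ∀ n ≥ N, ∀ m, betaCyl β n x ⊆ cfCyl m x → m ≤ 2 * n^2 + K := by
    intro n hn m hm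
    have h1 := len_mono (hI1 m) hm
    have h2 := hlow n hn
    have h3 := hIlen m
    have h4 : (2:ℝ)^m < 2^(2*n^2+K) := by
      have e : (2:ℝ)^(2*n^2+K) = 4^(n^2) * 2^K := by
        rw [pow_add, pow_mul]; norm_num
      rw [div_lt_iff₀ hNpos] at hK
      rw [e]
      refine lt_of_mul_lt_mul_right (a := c) ?_ hNpos.le
      calc (2:ℝ)^m * c ≤ 2^m * (4 ^ (n^2) * len (cfCyl m x)) := by
            gcongr; exact h2.trans (by gcongr)
        _ = 4^(n^2) * (2^m * len (cfCyl m x)) := by ring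
        _ ≤ 4^(n^2) * 16 := by gcongr
        _ < 4^(n^2) * (2^K * c) := by gcongr
        _ = _ := by ring
    exact ((pow_lt_pow_iff_right₀ (by norm_num : (1:ℝ) < 2)).1 h4).le
  have hmem : ∀ n ≥ N, betaCyl β n x ⊆ cfCyl (kCF β n x) x := by
    intro n hn
    have := Nat.sSup_mem (s := {m | betaCyl β n x ⊆ cfCyl m x})
      ⟨0, fun y hy => ⟨hy.1, fun i a b => by omega⟩⟩ ⟨_, fun m hm => hKb n hn m hm⟩
    exact this
  have hge : ∀ n ≥ N, ∀ m, betaCyl β n x ⊆ cfCyl m x → m ≤ kCF β n x := by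
    intro n hn m hm
    exact le_csSup ⟨_, fun m hm => hKb n hn m hm⟩ hm
  refine ⟨M+1, N + K + M + 5, fun n hn => ⟨?_, ?_⟩⟩
  · exact hge (n+1) (by omega) _ ((hJm n).trans (hmem n (by omega)))
  set k := kCF β n x with hk
  set k' := kCF β (n+1) x with hk'
  refine ⟨k' - (k+1+M), by omega, ?_⟩
  rcases le_total k' (k+1+M) with hle | hle
  · rw [Nat.sub_eq_zero_of_le hle, pow_zero]
    have : (1:ℝ) ≤ ((n:ℝ)+1)^8 := one_le_pow₀ (by linarith [n.cast_nonneg (α := ℝ)])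
    linarith
  obtain ⟨d, hd⟩ := Nat.exists_eq_add_of_le hle
  rw [hd, Nat.add_sub_cancel_left]
  set m := k+1+M with hm
  obtain ⟨y, hyJ, hyI⟩ : ∃ y ∈ betaCyl β n x, y ∉ cfCyl m x := by
    by_contra hcon
    push Not at hcon
    have := hge n (by omega) m hcon
    omega
  have a1 := hM m (by omega) y hyI
  have a2 := abs_le_len (hJ1 n) (betaCyl_conn β hβ x n) (hxJ n) hyJ
  have a3 := hN n (by omega)
  have a4 := len_mono (hI1 k') (hmem (n+1) (by omega))
  have a5 := cf_len' x hx hi m d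
  rw [hd] at a4
  rw [one_div, inv_mul_lt_iff₀ (by positivity)] at a1 a3
  have hkb := hKb n (by omega) k (hmem n (by omega))
  have hmb : m + 1 ≤ (n+1)^3 := by nlinarith
  have hmb' : (m:ℝ)+1 ≤ ((n:ℝ)+1)^3 := by exact_mod_cast hmb
  set L := len (cfCyl (m+d) x) with hL
  have Lpos : 0 < L := by
    have := l0 (betaCyl β n x)
    have h8 : 0 < len (betaCyl β (n+1) x) := by
      by_contra hneg
      nlinarith [sq_nonneg ((n:ℝ)+1)]
    linarith
  refine le_of_mul_le_mul_right (a := L) ?_ Lpos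
  calc 2^d * L ≤ 16 * len (cfCyl m x) := a5
    _ ≤ 16 * (((m:ℝ)+1)^2 * |x - y|) := by gcongr
    _ ≤ 16 * (((m:ℝ)+1)^2 * (((n:ℝ)+1)^2 * L)) := by
      gcongr
      refine a2.trans (a3.le.trans ?_)
      gcongr
    _ ≤ 16 * ((((n:ℝ)+1)^3)^2 * (((n:ℝ)+1)^2 * L)) := by gcongr
    _ = _ := by ring

end KN

theorem kn_increments_loglog (β : ℝ) (hβ : 1 < β) :
    ∀ᵐ x ∂(volume.restrict (Set.Ico (0:ℝ) 1)),
      Tendsto (fun n : ℕ =>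
          ((kCF β (n + 1) x : ℝ) - (kCF β n x : ℝ)) /
            Real.sqrt (n * Real.log (Real.log n))) atTop (nhds 0) := by
  filter_upwards [KN.ae_facts β hβ] with x hx
  obtain ⟨hx, hi, ⟨M, hM⟩, ⟨N, hN⟩⟩ := hx
  obtain ⟨C, R, hCR⟩ := KN.det_bound β hβ x hx hi M hM N hN
  have hcast : Tendsto (fun n : ℕ => (n:ℝ)) atTop atTop := tendsto_natCast_atTop_atTop
  -- log n / sqrt n
  have T1 : Tendsto (fun n : ℕ => Real.log n / Real.sqrt n) atTop (nhds 0) := by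
    have h := (isLittleO_log_rpow_atTop (r := 1/2) (by norm_num)).tendsto_div_nhds_zero
    have h2 := h.comp hcast
    refine h2.congr fun n => ?_
    simp [Real.sqrt_eq_rpow]
  have T2 : Tendsto (fun n : ℕ => 1 / Real.sqrt n) atTop (nhds 0) :=
    (tendsto_const_nhds (x := (1:ℝ))).div_atTop (Real.tendsto_sqrt_atTop.comp hcast)
  have T3 : Tendsto (fun n : ℕ => (8 / Real.log 2) * (Real.log n / Real.sqrt n) +
      (C + (Real.log 16 + 8 * Real.log 2) / Real.log 2) * (1 / Real.sqrt n)) atTop (nhds 0) := by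
    simpa using (T1.const_mul (8 / Real.log 2)).add
      (T2.const_mul (C + (Real.log 16 + 8 * Real.log 2) / Real.log 2))
  have E1 : ∀ᶠ n : ℕ in atTop, 1 ≤ Real.log (Real.log n) :=
    (Real.tendsto_log_atTop.comp (Real.tendsto_log_atTop.comp hcast)).eventually_ge_atTop 1
  refine squeeze_zero' ?_ ?_ T3
  · filter_upwards [eventually_ge_atTop R] with n hn
    have : (kCF β n x : ℝ) ≤ kCF β (n+1) x := by exact_mod_cast (hCR n hn).1
    exact div_nonneg (by linarith) (Real.sqrt_nonneg _)
  · filter_upwards [eventually_ge_atTop R, eventually_ge_atTop 1, E1] with n hn hn1 hll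
    obtain ⟨hk, d, hd1, hd2⟩ := hCR n hn
    have hn0 : (1:ℝ) ≤ n := by exact_mod_cast hn1
    have hs : 0 < Real.sqrt n := Real.sqrt_pos.2 (by linarith)
    have hk' : (kCF β n x : ℝ) ≤ kCF β (n+1) x := by exact_mod_cast hk
    have hd1' : (kCF β (n+1) x : ℝ) ≤ kCF β n x + d + C := by exact_mod_cast hd1
    have hl2 : 0 < Real.log 2 := Real.log_pos (by norm_num)
    have hd3 : (2:ℝ)^d ≤ 16 * (2 * (n:ℝ))^8 := by
      refine hd2.trans ?_
      gcongr; linarith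
    have hd4 := Real.log_le_log (by positivity) hd3
    rw [Real.log_pow, Real.log_mul (by norm_num) (by positivity), Real.log_pow,
      Real.log_mul (by norm_num) (by positivity)] at hd4
    push_cast at hd4
    have hd5 : (d:ℝ) ≤ (8 / Real.log 2) * Real.log n + (Real.log 16 + 8 * Real.log 2) / Real.log 2 := by
      have : (8 / Real.log 2) * Real.log n + (Real.log 16 + 8 * Real.log 2) / Real.log 2
        = (Real.log 16 + 8 * (Real.log 2 + Real.log n)) / Real.log 2 := by field_simp; ring
      rw [this, le_div_iff₀ hl2]; exact hd4
    calc ((kCF β (n + 1) x : ℝ) - (kCF β n x : ℝ)) / Real.sqrt (n * Real.log (Real.log n))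
        ≤ ((kCF β (n + 1) x : ℝ) - (kCF β n x : ℝ)) / Real.sqrt n := by
          apply div_le_div_of_nonneg_left (by linarith) hs
          apply Real.sqrt_le_sqrt
          nlinarith
      _ ≤ ((8 / Real.log 2) * Real.log n +
          (C + (Real.log 16 + 8 * Real.log 2) / Real.log 2)) / Real.sqrt n := by
          gcongr; linarith
      _ = _ := by ring
end
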